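/- arXiv:1409.7274 — 2 statements merged into one kernel-verified Lean document; each statement's English description precedes it below -/
import Mathlib

section
/- Let 𝒞 be a triangulated category with a proper class ξ of triangles and enough ξ-projectives, and let A be an object of 𝒞. Then A admits a ξ-projective resolution which is Hom(−, 𝒫(ξ))-exact if and only if A admits a ξ-Gorenstein projective resolution which is Hom(−, 𝒫(ξ))-exact. -/
open CategoryTheory CategoryTheory.Limits CategoryTheory.Pretriangulated

namespace GorensteinTriangulated

variable {C : Type*} [Category C] [HasZeroObject C] [HasShift C ℤ] [Preadditive C]
  [∀ n : ℤ, (shiftFunctor C n).Additive] [Pretriangulated C]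

/-- A triangle `A ⟶ B ⟶ C ⟶ ΣA` is split if it is isomorphic to the triangle
`A ⟶ A ⊞ C ⟶ C ⟶ ΣA` with structure maps `(1 0)`, `(0 1)ᵀ` and `0`. -/
def IsSplitTriangle (T : Triangle C) : Prop :=
  Nonempty (T ≅ Triangle.mk (biprod.inl : T.obj₁ ⟶ T.obj₁ ⊞ T.obj₃) biprod.snd
    (0 : T.obj₃ ⟶ T.obj₁⟦(1 : ℤ)⟧))

/-- The triangle `T` becomes a short exact sequence after applying `Hom(Q, -)`. -/
def CoExact (T : Triangle C) (Q : C) : Prop :=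
  Function.Injective (fun φ : Q ⟶ T.obj₁ => φ ≫ T.mor₁) ∧
  (∀ φ : Q ⟶ T.obj₂, φ ≫ T.mor₂ = 0 → ∃ ψ : Q ⟶ T.obj₁, φ = ψ ≫ T.mor₁) ∧
  Function.Surjective (fun φ : Q ⟶ T.obj₂ => φ ≫ T.mor₂)

/-- The triangle `T` becomes a short exact sequence after applying `Hom(-, Q)`. -/
def ContraExact (T : Triangle C) (Q : C) : Prop :=
  Function.Injective (fun φ : T.obj₃ ⟶ Q => T.mor₂ ≫ φ) ∧
  (∀ φ : T.obj₂ ⟶ Q, T.mor₁ ≫ φ = 0 → ∃ ψ : T.obj₃ ⟶ Q, φ = T.mor₂ ≫ ψ) ∧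
  Function.Surjective (fun φ : T.obj₂ ⟶ Q => T.mor₁ ≫ φ)

/-- Saturation of a class of triangles with respect to base change: in a base change
diagram, if the third vertical triangle and the second horizontal triangle are in `S`,
then the original triangle is in `S`. -/
def SaturatedBase (S : Set (Triangle C)) : Prop :=
  ∀ T ∈ (distinguishedTriangles : Set (Triangle C)),
    ∀ (M G E : C) (α : M ⟶ G) (δ : M ⟶ E) (f' : T.obj₁ ⟶ G) (g' : G ⟶ E)
      (h' : E ⟶ T.obj₁⟦(1 : ℤ)⟧) (β : G ⟶ T.obj₂) (ε : E ⟶ T.obj₃)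
      (γ : T.obj₂ ⟶ M⟦(1 : ℤ)⟧) (ζ : T.obj₃ ⟶ M⟦(1 : ℤ)⟧),
      Triangle.mk α β γ ∈ (distinguishedTriangles : Set (Triangle C)) →
      Triangle.mk f' g' h' ∈ S → Triangle.mk δ ε ζ ∈ S →
      α ≫ g' = δ → f' ≫ β = T.mor₁ → g' ≫ ε = β ≫ T.mor₂ → h' = ε ≫ T.mor₃ →
      T.mor₂ ≫ ζ = γ → T ∈ S

/-- Saturation of a class of triangles with respect to cobase change: in a cobase change
diagram, if the second vertical triangle and the third horizontal triangle are in `S`,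
then the original triangle is in `S`. -/
def SaturatedCobase (S : Set (Triangle C)) : Prop :=
  ∀ T ∈ (distinguishedTriangles : Set (Triangle C)),
    ∀ (N D F : C) (ζ : N ⟶ T.obj₁) (δ : N ⟶ T.obj₂) (α : T.obj₁ ⟶ D) (β : T.obj₂ ⟶ F)
      (f' : D ⟶ F) (g' : F ⟶ T.obj₃) (h' : T.obj₃ ⟶ D⟦(1 : ℤ)⟧)
      (η : D ⟶ N⟦(1 : ℤ)⟧) (υ : F ⟶ N⟦(1 : ℤ)⟧),
      Triangle.mk ζ α η ∈ (distinguishedTriangles : Set (Triangle C)) →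
      Triangle.mk δ β υ ∈ S → Triangle.mk f' g' h' ∈ S →
      ζ ≫ T.mor₁ = δ → T.mor₁ ≫ β = α ≫ f' → T.mor₂ = β ≫ g' →
      T.mor₃ ≫ (shiftFunctor C (1 : ℤ)).map α = h' → f' ≫ υ = η → T ∈ S

/-- A proper class of triangles in the sense of Beligiannis. -/
structure IsProperClass (S : Set (Triangle C)) : Prop where
  subset_dist : S ⊆ (distinguishedTriangles : Set (Triangle C))
  split_mem : ∀ T : Triangle C, T ∈ (distinguishedTriangles : Set (Triangle C)) →
    IsSplitTriangle T → T ∈ S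
  iso_closed : ∀ T₁ T₂ : Triangle C, Nonempty (T₁ ≅ T₂) → T₁ ∈ S → T₂ ∈ S
  sum_closed : ∀ T₁ ∈ S, ∀ T₂ ∈ S, ∀ T ∈ (distinguishedTriangles : Set (Triangle C)),
    Nonempty (T.obj₁ ≅ T₁.obj₁ ⊞ T₂.obj₁) →
    (∀ e₁ : T.obj₁ ≅ T₁.obj₁ ⊞ T₂.obj₁, ∀ e₂ : T.obj₂ ≅ T₁.obj₂ ⊞ T₂.obj₂,
      ∀ e₃ : T.obj₃ ≅ T₁.obj₃ ⊞ T₂.obj₃,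
      T.mor₁ = e₁.hom ≫ biprod.map T₁.mor₁ T₂.mor₁ ≫ e₂.inv →
      T.mor₂ = e₂.hom ≫ biprod.map T₁.mor₂ T₂.mor₂ ≫ e₃.inv →
      T.mor₃ = e₃.hom ≫ biprod.desc
        (T₁.mor₃ ≫ (shiftFunctor C (1 : ℤ)).map (biprod.inl ≫ e₁.inv))
        (T₂.mor₃ ≫ (shiftFunctor C (1 : ℤ)).map (biprod.inr ≫ e₁.inv)) → T ∈ S)
  susp_closed : ∀ T ∈ S, ∀ i : ℤ, (Triangle.shiftFunctor C i).obj T ∈ S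
  saturated : SaturatedBase S
  base_change : ∀ T ∈ S, ∀ {E : C} (ε : E ⟶ T.obj₃),
    ∃ (G : C) (f' : T.obj₁ ⟶ G) (g' : G ⟶ E) (h' : E ⟶ T.obj₁⟦(1 : ℤ)⟧) (β : G ⟶ T.obj₂),
      Triangle.mk f' g' h' ∈ S ∧ f' ≫ β = T.mor₁ ∧ g' ≫ ε = β ≫ T.mor₂ ∧ h' = ε ≫ T.mor₃
  cobase_change : ∀ T ∈ S, ∀ {D : C} (α : T.obj₁ ⟶ D),
    ∃ (F : C) (f' : D ⟶ F) (g' : F ⟶ T.obj₃) (h' : T.obj₃ ⟶ D⟦(1 : ℤ)⟧) (β : T.obj₂ ⟶ F),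
      Triangle.mk f' g' h' ∈ S ∧ T.mor₁ ≫ β = α ≫ f' ∧ T.mor₂ = β ≫ g' ∧
      T.mor₃ ≫ (shiftFunctor C (1 : ℤ)).map α = h'

/-- `P` is a `ξ`-projective object. -/
def XiProjective (S : Set (Triangle C)) (P : C) : Prop :=
  ∀ T ∈ S, CoExact T P

/-- `𝒞` has enough `ξ`-projectives. -/
def HasEnoughXiProjectives (S : Set (Triangle C)) : Prop :=
  ∀ A : C, ∃ (K P : C) (f : K ⟶ P) (g : P ⟶ A) (h : A ⟶ K⟦(1 : ℤ)⟧),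
    XiProjective S P ∧ Triangle.mk f g h ∈ S

/-- The objects admitting a complete resolution by triangles in `S` with middle terms in
`X` which are `Hom(-, Y)`-exact; `GClass S X X` is the Gorenstein category `𝒢(X)` and
`GClass S (XiProjective S) (XiProjective S)` is the class of `ξ`-Gorenstein projectives. -/
def GClass (S : Set (Triangle C)) (X Y : C → Prop) (A : C) : Prop :=
  ∃ (K P : ℤ → C) (f : ∀ n : ℤ, K (n + 1) ⟶ P n) (g : ∀ n : ℤ, P n ⟶ K n)
    (h : ∀ n : ℤ, K n ⟶ (K (n + 1))⟦(1 : ℤ)⟧),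
    K 0 = A ∧ ∀ n : ℤ, X (P n) ∧ Triangle.mk (f n) (g n) (h n) ∈ S ∧
      ∀ Q : C, Y Q → ContraExact (Triangle.mk (f n) (g n) (h n)) Q

/-- `ξ`-Gorenstein projective objects. -/
def GProjective (S : Set (Triangle C)) (A : C) : Prop :=
  GClass S (XiProjective S) (XiProjective S) A

/-- A `ξ`-exact resolution `⋯ → X₁ → X₀ → A → 0` with terms satisfying `X`, which is
`Hom(-, Q)`-exact for every `Q` satisfying `Y`. -/
def HasResolution (S : Set (Triangle C)) (X Y : C → Prop) (A : C) : Prop :=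
  ∃ (K G : ℕ → C) (f : ∀ n : ℕ, K (n + 1) ⟶ G n) (g : ∀ n : ℕ, G n ⟶ K n)
    (h : ∀ n : ℕ, K n ⟶ (K (n + 1))⟦(1 : ℤ)⟧),
    K 0 = A ∧ ∀ n : ℕ, X (G n) ∧ Triangle.mk (f n) (g n) (h n) ∈ S ∧
      ∀ Q : C, Y Q → ContraExact (Triangle.mk (f n) (g n) (h n)) Q

/-- A `ξ`-exact coresolution `0 → A → X⁰ → X¹ → ⋯` with terms satisfying `X`, which is
`Hom(-, Q)`-exact for every `Q` satisfying `Y`. -/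
def HasCoresolution (S : Set (Triangle C)) (X Y : C → Prop) (A : C) : Prop :=
  ∃ (K G : ℕ → C) (f : ∀ n : ℕ, K n ⟶ G n) (g : ∀ n : ℕ, G n ⟶ K (n + 1))
    (h : ∀ n : ℕ, K (n + 1) ⟶ (K n)⟦(1 : ℤ)⟧),
    K 0 = A ∧ ∀ n : ℕ, X (G n) ∧ Triangle.mk (f n) (g n) (h n) ∈ S ∧
      ∀ Q : C, Y Q → ContraExact (Triangle.mk (f n) (g n) (h n)) Q

/-- A finite `ξ`-exact sequence `0 → Gₙ → ⋯ → G₀ → A → 0` where the `j`-th term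
satisfies the predicate `X j`. -/
def FiniteRes (S : Set (Triangle C)) (n : ℕ) (X : ℕ → C → Prop) (A : C) : Prop :=
  ∃ (K G : ℕ → C) (f : ∀ j : ℕ, K (j + 1) ⟶ G j) (g : ∀ j : ℕ, G j ⟶ K j)
    (h : ∀ j : ℕ, K j ⟶ (K (j + 1))⟦(1 : ℤ)⟧),
    K 0 = A ∧ IsZero (K (n + 1)) ∧
    ∀ j ≤ n, X j (G j) ∧ Triangle.mk (f j) (g j) (h j) ∈ S

/-- `ξ`-Gorenstein projective dimension of `A` is at most `n`. -/
def GpdLE (S : Set (Triangle C)) (A : C) (n : ℕ) : Prop :=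
  FiniteRes S n (fun _ => GProjective S) A

variable [IsTriangulated C]

set_option linter.unusedSectionVars false

lemma distinguished_of_iso {X Y Z X' Y' Z' : C} {f : X ⟶ Y} {g : Y ⟶ Z} {h : Z ⟶ X⟦(1 : ℤ)⟧}
    {f' : X' ⟶ Y'} {g' : Y' ⟶ Z'} {h' : Z' ⟶ X'⟦(1 : ℤ)⟧} (e₁ : X' ≅ X) (e₂ : Y' ≅ Y)
    (e₃ : Z' ≅ Z) (comm₁ : f' ≫ e₂.hom = e₁.hom ≫ f) (comm₂ : g' ≫ e₃.hom = e₂.hom ≫ g)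
    (comm₃ : h' ≫ e₁.hom⟦(1 : ℤ)⟧' = e₃.hom ≫ h)
    (H : Triangle.mk f g h ∈ (distinguishedTriangles : Set (Triangle C))) :
    Triangle.mk f' g' h' ∈ (distinguishedTriangles : Set (Triangle C)) :=
  isomorphic_distinguished _ H _ (Triangle.isoMk _ _ e₁ e₂ e₃ comm₁ comm₂ comm₃)

lemma distinguished_rotate_iff {X Y Z : C} {f : X ⟶ Y} {g : Y ⟶ Z} {h : Z ⟶ X⟦(1 : ℤ)⟧} :
    Triangle.mk f g h ∈ (distinguishedTriangles : Set (Triangle C)) ↔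
      Triangle.mk g h (-f⟦(1 : ℤ)⟧') ∈ (distinguishedTriangles : Set (Triangle C)) :=
  rotate_distinguished_triangle _

lemma distinguished_of_shift {X Y Z : C} {f : X ⟶ Y} {g : Y ⟶ Z} {h : Z ⟶ X⟦(1 : ℤ)⟧}
    (H : Triangle.mk (f⟦(1 : ℤ)⟧') (g⟦(1 : ℤ)⟧') (-h⟦(1 : ℤ)⟧') ∈
      (distinguishedTriangles : Set (Triangle C))) :
    Triangle.mk f g h ∈ (distinguishedTriangles : Set (Triangle C)) := by
  rw [distinguished_rotate_iff, distinguished_rotate_iff, distinguished_rotate_iff]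
  exact distinguished_of_iso (Iso.refl _) ⟨-𝟙 _, -𝟙 _, by simp, by simp⟩ (Iso.refl _)
    (by simp) (by simp) (by simp) H

/-- Homotopy pullback of two distinguished triangles with the same third object. -/
lemma exists_homotopy_pullback {X Y Z M E : C} {f : X ⟶ Y} {g : Y ⟶ Z} {h : Z ⟶ X⟦(1 : ℤ)⟧}
    (H : Triangle.mk f g h ∈ (distinguishedTriangles : Set (Triangle C)))
    {δ : M ⟶ E} {ε : E ⟶ Z} {ζ : Z ⟶ M⟦(1 : ℤ)⟧}
    (H' : Triangle.mk δ ε ζ ∈ (distinguishedTriangles : Set (Triangle C))) :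
    ∃ (G : C) (f' : X ⟶ G) (g' : G ⟶ E) (α : M ⟶ G) (β : G ⟶ Y),
      Triangle.mk f' g' (ε ≫ h) ∈ (distinguishedTriangles : Set (Triangle C)) ∧
      Triangle.mk α β (g ≫ ζ) ∈ (distinguishedTriangles : Set (Triangle C)) ∧
      α ≫ g' = δ ∧ f' ≫ β = f ∧ g' ≫ ε = β ≫ g := by
  obtain ⟨G, α, β, hG⟩ := distinguished_cocone_triangle₂ (g ≫ ζ)
  have O := Triangulated.someOctahedron (rfl : g ≫ ζ = g ≫ ζ) (distinguished_rotate_iff.1 H)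
    (distinguished_rotate_iff.1 (distinguished_rotate_iff.1 H'))
    (distinguished_rotate_iff.1 (distinguished_rotate_iff.1 hG))
  obtain ⟨f', hf'⟩ := (shiftFunctor C (1 : ℤ)).map_surjective O.m₁
  obtain ⟨g', hg'⟩ := (shiftFunctor C (1 : ℤ)).map_surjective O.m₃
  have h2 := O.comm₂
  have h3 := O.comm₃
  have h4 := O.comm₄
  have hm := O.mem
  rw [← hf'] at h2 hm
  rw [← hg'] at h3 h4 hm
  refine ⟨G, f', g', α, β, distinguished_of_shift ?_, hG, ?_, ?_, ?_⟩
  · rw [Functor.map_comp, ← Preadditive.neg_comp]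
    exact hm
  · apply (shiftFunctor C (1 : ℤ)).map_injective
    simpa using h3
  · apply (shiftFunctor C (1 : ℤ)).map_injective
    simpa [← Functor.map_comp] using h2
  · apply (shiftFunctor C (1 : ℤ)).map_injective
    simpa using h4.symm

section Projectives

variable {S : Set (Triangle C)}

lemma XiProjective.comp_mor₃ {Q : C} (hS : IsProperClass S) (hQ : XiProjective S Q)
    {T : Triangle C} (hT : T ∈ S) (φ : Q ⟶ T.obj₃) : φ ≫ T.mor₃ = 0 := by
  obtain ⟨ψ, rfl⟩ := (hQ T hT).2.2 φ
  dsimp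
  rw [Category.assoc, comp_distTriang_mor_zero₂₃ _ (hS.subset_dist hT), comp_zero]

lemma comp_shift_mor₃ {Q : C} (hS : IsProperClass S)
    (hQ : ∀ T ∈ S, ∀ φ : Q ⟶ T.obj₃, φ ≫ T.mor₃ = 0)
    {T : Triangle C} (hT : T ∈ S) (n : ℤ) (φ : Q ⟶ T.obj₃⟦n⟧) : φ ≫ T.mor₃⟦n⟧' = 0 := by
  have h := hQ _ (hS.susp_closed T hT n) φ
  have h' : φ ≫ (n.negOnePow • T.mor₃⟦n⟧' ≫ (shiftFunctorComm C 1 n).hom.app T.obj₁) = 0 := h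
  rw [Linear.comp_units_smul, smul_eq_zero_iff_eq, ← Category.assoc] at h'
  exact (Preadditive.IsIso.comp_right_eq_zero _ _).1 h'

lemma xiProjective_of_comp_mor₃ {Q : C} (hS : IsProperClass S)
    (hQ : ∀ T ∈ S, ∀ φ : Q ⟶ T.obj₃, φ ≫ T.mor₃ = 0) : XiProjective S Q := by
  intro T hT
  have hd := hS.subset_dist hT
  refine ⟨?_, fun φ hφ => T.coyoneda_exact₂ hd φ hφ, fun φ => ?_⟩
  · intro a b hab
    have h0 : (a - b) ≫ T.mor₁ = 0 := by simpa [sub_eq_zero] using hab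
    obtain ⟨ψ, hψ⟩ : ∃ ψ : Q ⟶ T.obj₃⟦(-1 : ℤ)⟧, a - b = ψ ≫
        (-(T.mor₃⟦(-1 : ℤ)⟧' ≫ (shiftFunctorCompIsoId C (1 : ℤ) (-1) (by simp)).hom.app _)) :=
      Triangle.coyoneda_exact₂ _ (inv_rot_of_distTriang _ hd) (a - b) h0
    rw [← sub_eq_zero, hψ, Preadditive.comp_neg, ← Category.assoc,
      comp_shift_mor₃ hS hQ hT (-1) ψ, zero_comp, neg_zero]
  · obtain ⟨ψ, hψ⟩ := T.coyoneda_exact₃ hd φ (hQ T hT φ)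
    exact ⟨ψ, hψ.symm⟩

lemma XiProjective.shift {Q : C} (hS : IsProperClass S) (hQ : XiProjective S Q) (n : ℤ) :
    XiProjective S (Q⟦n⟧) := by
  refine xiProjective_of_comp_mor₃ hS fun T hT φ => ?_
  apply (shiftFunctor C (-n)).map_injective
  have h := comp_shift_mor₃ hS (fun T hT φ => hQ.comp_mor₃ hS hT φ) hT (-n)
    ((shiftFunctorCompIsoId C n (-n) (by simp)).inv.app Q ≫ φ⟦-n⟧')
  rw [Category.assoc, ← Functor.map_comp] at h
  rw [Functor.map_zero]
  exact (Preadditive.IsIso.comp_left_eq_zero _ _).1 h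

lemma XiProjective.of_iso {P Q : C} (hS : IsProperClass S) (hP : XiProjective S P)
    (e : P ≅ Q) : XiProjective S Q := by
  refine xiProjective_of_comp_mor₃ hS fun T hT φ => ?_
  have h := hP.comp_mor₃ hS hT (e.hom ≫ φ)
  rw [Category.assoc] at h
  exact (Preadditive.IsIso.comp_left_eq_zero _ _).1 h

lemma XiProjective.biprod {P Q : C} (hS : IsProperClass S) (hP : XiProjective S P)
    (hQ : XiProjective S Q) : XiProjective S (P ⊞ Q) := by
  refine xiProjective_of_comp_mor₃ hS fun T hT φ => ?_
  ext
  · simpa using hP.comp_mor₃ hS hT (biprod.inl ≫ φ)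
  · simpa using hQ.comp_mor₃ hS hT (biprod.inr ≫ φ)

lemma mem_of_mor₃_eq_zero (hS : IsProperClass S) {T : Triangle C}
    (hT : T ∈ (distinguishedTriangles : Set (Triangle C))) (h : T.mor₃ = 0) : T ∈ S := by
  obtain ⟨e, he₁, he₂⟩ := exists_iso_binaryBiproduct_of_distTriang T hT h
  exact hS.split_mem T hT ⟨Triangle.isoMk _ _ (Iso.refl _) e (Iso.refl _)
    (he₁.trans (Category.id_comp _).symm) ((Category.comp_id _).trans he₂)
    (by rw [h, zero_comp]; exact comp_zero.symm)⟩

/-- A distinguished triangle belongs to a proper class as soon as its third morphism is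
annihilated by all `ξ`-projectives. -/
lemma mem_of_comp_mor₃ (hS : IsProperClass S) (hE : HasEnoughXiProjectives S) {T : Triangle C}
    (hT : T ∈ (distinguishedTriangles : Set (Triangle C)))
    (h : ∀ Q, XiProjective S Q → ∀ φ : Q ⟶ T.obj₃, φ ≫ T.mor₃ = 0) : T ∈ S := by
  obtain ⟨M, E, δ, ε, ζ, hP, hM⟩ := hE T.obj₃
  obtain ⟨G, f', g', α, β, h₁, h₂, h₃, h₄, h₅⟩ :=
    exists_homotopy_pullback (f := T.mor₁) (g := T.mor₂) (h := T.mor₃) hT (hS.subset_dist hM)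
  exact hS.saturated T hT M G E α δ f' g' (ε ≫ T.mor₃) β ε (T.mor₂ ≫ ζ) ζ h₂
    (mem_of_mor₃_eq_zero hS h₁ (h E hP ε)) hM h₃ h₄ h₅ rfl rfl

variable (S) in
/-- A distinguished triangle whose third morphism is annihilated by composition with all
morphisms from and to `ξ`-projectives. -/
def IsBiexact (T : Triangle C) : Prop :=
  T ∈ (distinguishedTriangles : Set (Triangle C)) ∧ ∀ Q, XiProjective S Q →
    (∀ φ : Q ⟶ T.obj₃, φ ≫ T.mor₃ = 0) ∧ ∀ ψ : T.obj₁⟦(1 : ℤ)⟧ ⟶ Q, T.mor₃ ≫ ψ = 0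

lemma IsBiexact.of_mor₃_eq_zero {T : Triangle C}
    (hT : T ∈ (distinguishedTriangles : Set (Triangle C))) (h : T.mor₃ = 0) : IsBiexact S T :=
  ⟨hT, fun _ _ => ⟨fun φ => by rw [h, comp_zero], fun ψ => by rw [h, zero_comp]⟩⟩

lemma isBiexact_iff (hS : IsProperClass S) (hE : HasEnoughXiProjectives S) (T : Triangle C) :
    IsBiexact S T ↔ T ∈ S ∧ ∀ Q, XiProjective S Q → ContraExact T Q := by
  constructor
  · rintro ⟨hT, h⟩
    refine ⟨mem_of_comp_mor₃ hS hE hT fun Q hQ => (h Q hQ).1, fun Q hQ => ⟨?_, ?_, ?_⟩⟩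
    · intro a b hab
      have h0 : T.mor₂ ≫ (a - b) = 0 := by simpa [sub_eq_zero] using hab
      obtain ⟨χ, hχ⟩ := T.yoneda_exact₃ hT _ h0
      rw [← sub_eq_zero, hχ, (h Q hQ).2 χ]
    · exact fun φ hφ => T.yoneda_exact₂ hT φ hφ
    · intro φ
      obtain ⟨χ, hχ⟩ : ∃ χ : T.obj₂⟦(1 : ℤ)⟧ ⟶ Q⟦(1 : ℤ)⟧,
          φ⟦(1 : ℤ)⟧' = (-T.mor₁⟦(1 : ℤ)⟧') ≫ χ :=
        Triangle.yoneda_exact₂ _ (rot_of_distTriang _ (rot_of_distTriang _ hT))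
          (φ⟦(1 : ℤ)⟧') ((h _ (hQ.shift hS 1)).2 _)
      obtain ⟨χ', rfl⟩ := (shiftFunctor C (1 : ℤ)).map_surjective χ
      refine ⟨-χ', (shiftFunctor C (1 : ℤ)).map_injective ?_⟩
      rw [hχ]
      simp
  · rintro ⟨hT, h⟩
    have hd := hS.subset_dist hT
    refine ⟨hd, fun Q hQ => ⟨fun φ => hQ.comp_mor₃ hS hT φ, fun ψ => (h Q hQ).1 ?_⟩⟩
    dsimp
    rw [← Category.assoc, comp_distTriang_mor_zero₂₃ _ hd, zero_comp, comp_zero]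

section Mk

variable {X Y Z Q : C} {f : X ⟶ Y} {g : Y ⟶ Z} {h : Z ⟶ X⟦(1 : ℤ)⟧}

lemma IsBiexact.mk (H : Triangle.mk f g h ∈ (distinguishedTriangles : Set (Triangle C)))
    (h₁ : ∀ Q, XiProjective S Q → ∀ φ : Q ⟶ Z, φ ≫ h = 0)
    (h₂ : ∀ Q, XiProjective S Q → ∀ ψ : X⟦(1 : ℤ)⟧ ⟶ Q, h ≫ ψ = 0) :
    IsBiexact S (Triangle.mk f g h) :=
  ⟨H, fun Q hQ => ⟨h₁ Q hQ, h₂ Q hQ⟩⟩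

lemma IsBiexact.comp_eq_zero (H : IsBiexact S (Triangle.mk f g h)) (hQ : XiProjective S Q)
    (φ : Q ⟶ Z) : φ ≫ h = 0 :=
  (H.2 Q hQ).1 φ

lemma IsBiexact.eq_zero_comp (H : IsBiexact S (Triangle.mk f g h)) (hQ : XiProjective S Q)
    (ψ : X⟦(1 : ℤ)⟧ ⟶ Q) : h ≫ ψ = 0 :=
  (H.2 Q hQ).2 ψ

end Mk

lemma IsBiexact.exists_pullback {X Y Z M E : C} {f : X ⟶ Y} {g : Y ⟶ Z} {h : Z ⟶ X⟦(1 : ℤ)⟧}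
    (H : IsBiexact S (Triangle.mk f g h))
    {δ : M ⟶ E} {ε : E ⟶ Z} {ζ : Z ⟶ M⟦(1 : ℤ)⟧} (H' : IsBiexact S (Triangle.mk δ ε ζ)) :
    ∃ (G : C) (f' : X ⟶ G) (g' : G ⟶ E) (α : M ⟶ G) (β : G ⟶ Y),
      IsBiexact S (Triangle.mk f' g' (ε ≫ h)) ∧ IsBiexact S (Triangle.mk α β (g ≫ ζ)) := by
  obtain ⟨G, f', g', α, β, h₁, h₂, -⟩ := exists_homotopy_pullback H.1 H'.1
  refine ⟨G, f', g', α, β, .mk h₁ (fun Q hQ φ => ?_) (fun Q hQ ψ => ?_),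
    .mk h₂ (fun Q hQ φ => ?_) (fun Q hQ ψ => ?_)⟩
  · rw [← Category.assoc, H.comp_eq_zero hQ]
  · rw [Category.assoc, H.eq_zero_comp hQ, comp_zero]
  · rw [← Category.assoc, H'.comp_eq_zero hQ]
  · rw [Category.assoc, H'.eq_zero_comp hQ, comp_zero]

/-- The composite of two biexact deflations is a biexact deflation, and its kernel is an
extension of the two kernels. -/
lemma IsBiexact.exists_comp {K G A L P : C} {f : K ⟶ G} {g : G ⟶ A} {h : A ⟶ K⟦(1 : ℤ)⟧}
    (H : IsBiexact S (Triangle.mk f g h))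
    {f₂ : L ⟶ P} {g₂ : P ⟶ G} {h₂ : G ⟶ L⟦(1 : ℤ)⟧} (H₂ : IsBiexact S (Triangle.mk f₂ g₂ h₂)) :
    ∃ (B : C) (i : B ⟶ P) (k : A ⟶ B⟦(1 : ℤ)⟧) (a : L ⟶ B) (b : B ⟶ K),
      IsBiexact S (Triangle.mk i (g₂ ≫ g) k) ∧ IsBiexact S (Triangle.mk a b (f ≫ h₂)) := by
  obtain ⟨B, i, k, hB⟩ := distinguished_cocone_triangle₁ (g₂ ≫ g)
  have O := Triangulated.someOctahedron (rfl : g₂ ≫ g = g₂ ≫ g) (distinguished_rotate_iff.1 H₂.1)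
    (distinguished_rotate_iff.1 H.1) (distinguished_rotate_iff.1 hB)
  obtain ⟨a, ha⟩ := (shiftFunctor C (1 : ℤ)).map_surjective O.m₁
  obtain ⟨b, hb⟩ := (shiftFunctor C (1 : ℤ)).map_surjective O.m₃
  have h1 : h₂ ≫ O.m₁ = g ≫ k := O.comm₁
  have hm := O.mem
  rw [← ha, ← hb] at hm
  refine ⟨B, i, k, a, b, .mk hB (fun Q hQ φ => ?_) (fun Q hQ ψ => ?_),
    .mk (distinguished_of_shift ?_) (fun Q hQ φ => ?_) (fun Q hQ ψ => ?_)⟩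
  · obtain ⟨φ', rfl⟩ : ∃ φ' : Q ⟶ G, φ = φ' ≫ g :=
      Triangle.coyoneda_exact₃ _ H.1 φ (H.comp_eq_zero hQ φ)
    rw [Category.assoc, ← h1, ← Category.assoc, H₂.comp_eq_zero hQ, zero_comp]
  · have h2 : g ≫ k ≫ ψ = 0 := by
      rw [← Category.assoc, ← h1, Category.assoc, H₂.eq_zero_comp hQ]
    obtain ⟨χ, hχ⟩ : ∃ χ : K⟦(1 : ℤ)⟧ ⟶ Q, k ≫ ψ = h ≫ χ :=
      Triangle.yoneda_exact₃ _ H.1 (k ≫ ψ) h2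
    rw [hχ, H.eq_zero_comp hQ]
  · rw [Functor.map_comp, ← Preadditive.neg_comp]
    exact hm
  · rw [← Category.assoc, H₂.comp_eq_zero hQ]
  · rw [Category.assoc, H₂.eq_zero_comp hQ, comp_zero]

lemma IsBiexact.exists_symm_of_xiProjective {L E P : C} {f : L ⟶ E} {g : E ⟶ P}
    {h : P ⟶ L⟦(1 : ℤ)⟧} (H : IsBiexact S (Triangle.mk f g h)) (hP : XiProjective S P) :
    Nonempty (E ≅ L ⊞ P) ∧ ∃ (s : P ⟶ E) (r : E ⟶ L), IsBiexact S (Triangle.mk s r 0) := by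
  have h0 : h = 0 := by rw [← Category.id_comp h, H.comp_eq_zero hP]
  obtain ⟨e⟩ : Nonempty (E ≅ L ⊞ P) :=
    ⟨(exists_iso_binaryBiproduct_of_distTriang _ H.1 h0).choose⟩
  refine ⟨⟨e⟩, biprod.inr ≫ e.inv, e.hom ≫ biprod.fst, .of_mor₃_eq_zero ?_ rfl⟩
  refine distinguished_of_iso (Iso.refl _) (e ≪≫ biprod.braiding L P) (Iso.refl _) ?_ ?_ ?_
    (binaryBiproductTriangle_distinguished P L)
  · ext <;> simp
  · simp
  · simp

/-- Horseshoe lemma. -/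
lemma IsBiexact.exists_horseshoe (hS : IsProperClass S)
    {L A K L' P K' Q : C} {f : L ⟶ A} {g : A ⟶ K} {h : K ⟶ L⟦(1 : ℤ)⟧}
    (H : IsBiexact S (Triangle.mk f g h))
    {f₁ : L' ⟶ P} {g₁ : P ⟶ L} {h₁ : L ⟶ L'⟦(1 : ℤ)⟧} (H₁ : IsBiexact S (Triangle.mk f₁ g₁ h₁))
    (hP : XiProjective S P)
    {f₂ : K' ⟶ Q} {g₂ : Q ⟶ K} {h₂ : K ⟶ K'⟦(1 : ℤ)⟧} (H₂ : IsBiexact S (Triangle.mk f₂ g₂ h₂))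
    (hQ : XiProjective S Q) :
    ∃ (A' R : C) (i : A' ⟶ R) (p : R ⟶ A) (k : A ⟶ A'⟦(1 : ℤ)⟧)
      (a : L' ⟶ A') (b : A' ⟶ K') (c : K' ⟶ L'⟦(1 : ℤ)⟧), XiProjective S R ∧
      IsBiexact S (Triangle.mk i p k) ∧ IsBiexact S (Triangle.mk a b c) := by
  obtain ⟨E, f', g', α, β, hE₁, hE₂⟩ := H.exists_pullback H₂
  obtain ⟨-, s, r, hsr⟩ := hE₁.exists_symm_of_xiProjective hQ
  obtain ⟨R, u, v, α', β', hR₁, hR₂⟩ := hsr.exists_pullback H₁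
  obtain ⟨⟨e⟩, -⟩ := hR₁.exists_symm_of_xiProjective hP
  obtain ⟨A', i, k, a, b, hA, hA'⟩ := hE₂.exists_comp hR₂
  exact ⟨A', R, i, _, k, a, b, _, (hQ.biprod hS hP).of_iso hS e.symm, hA, hA'⟩

end Projectives

section Resolutions

variable {S : Set (Triangle C)}

lemma HasResolution.exists_biexact (hS : IsProperClass S) (hE : HasEnoughXiProjectives S)
    {X : C → Prop} {A : C} (h : HasResolution S X (XiProjective S) A) :
    ∃ (K G : C) (f : K ⟶ G) (g : G ⟶ A) (h : A ⟶ K⟦(1 : ℤ)⟧), X G ∧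
      IsBiexact S (Triangle.mk f g h) ∧ HasResolution S X (XiProjective S) K := by
  obtain ⟨K, G, f, g, h, rfl, H⟩ := h
  exact ⟨K 1, G 0, f 0, g 0, h 0, (H 0).1, (isBiexact_iff hS hE _).2 (H 0).2,
    fun n => K (n + 1), fun n => G (n + 1), fun n => f (n + 1), fun n => g (n + 1),
    fun n => h (n + 1), rfl, fun n => H (n + 1)⟩

lemma GProjective.exists_biexact (hS : IsProperClass S) (hE : HasEnoughXiProjectives S)
    {A : C} (h : GProjective S A) :
    ∃ (K P : C) (f : K ⟶ P) (g : P ⟶ A) (h : A ⟶ K⟦(1 : ℤ)⟧), XiProjective S P ∧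
      IsBiexact S (Triangle.mk f g h) ∧ GProjective S K := by
  obtain ⟨K, P, f, g, h, rfl, H⟩ := h
  exact ⟨K (0 + 1), P 0, f 0, g 0, h 0, (H 0).1, (isBiexact_iff hS hE _).2 (H 0).2,
    fun n => K (n + 1), fun n => P (n + 1), fun n => f (n + 1), fun n => g (n + 1),
    fun n => h (n + 1), rfl, fun n => H (n + 1)⟩

/-- Resolutions can be built step by step inside a class of objects. -/
lemma hasResolution_of_step (hS : IsProperClass S) (hE : HasEnoughXiProjectives S)
    {X R : C → Prop}
    (step : ∀ B, R B → ∃ (K G : C) (f : K ⟶ G) (g : G ⟶ B) (h : B ⟶ K⟦(1 : ℤ)⟧), X G ∧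
      IsBiexact S (Triangle.mk f g h) ∧ R K) {A : C} (hA : R A) :
    HasResolution S X (XiProjective S) A := by
  choose K G f g h hX hT hR using step
  let Z : ℕ → {B : C // R B} := fun n =>
    Nat.rec ⟨A, hA⟩ (fun _ B => ⟨K B.1 B.2, hR B.1 B.2⟩) n
  exact ⟨fun n => (Z n).1, fun n => G _ (Z n).2, fun n => f _ (Z n).2, fun n => g _ (Z n).2,
    fun n => h _ (Z n).2, rfl, fun n => ⟨hX _ _, (isBiexact_iff hS hE _).1 (hT _ (Z n).2)⟩⟩

lemma HasResolution.mono {X X' Y : C → Prop} {A : C} (hX : ∀ B, X B → X' B)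
    (h : HasResolution S X Y A) : HasResolution S X' Y A := by
  obtain ⟨K, G, f, g, h, hA, H⟩ := h
  exact ⟨K, G, f, g, h, hA, fun n => ⟨hX _ (H n).1, (H n).2⟩⟩

lemma XiProjective.gProjective (hS : IsProperClass S) (hE : HasEnoughXiProjectives S) {P : C}
    (hP : XiProjective S P) : GProjective S P :=
  ⟨fun _ => P, fun _ => P ⊞ P, fun _ => biprod.inl, fun _ => biprod.snd, fun _ => 0, rfl,
    fun _ => ⟨hP.biprod hS hP, (isBiexact_iff hS hE _).1
      (.of_mor₃_eq_zero (binaryBiproductTriangle_distinguished P P) rfl)⟩⟩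

variable (S) in
/-- Iterated biexact extensions, by `ξ`-Gorenstein projectives, of objects admitting a
`ξ`-Gorenstein projective resolution which is `Hom(-, 𝒫(ξ))`-exact. -/
inductive IsIteratedExtension : C → Prop
  | of_hasResolution {A : C} (h : HasResolution S (GProjective S) (XiProjective S) A) :
      IsIteratedExtension A
  | extension {L A K : C} (f : L ⟶ A) (g : A ⟶ K) (h : K ⟶ L⟦(1 : ℤ)⟧)
      (H : IsBiexact S (Triangle.mk f g h)) (hL : GProjective S L)
      (hK : IsIteratedExtension K) : IsIteratedExtension A

lemma IsIteratedExtension.exists_biexact (hS : IsProperClass S)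
    (hE : HasEnoughXiProjectives S) {A : C} (hA : IsIteratedExtension S A) :
    ∃ (K P : C) (f : K ⟶ P) (g : P ⟶ A) (h : A ⟶ K⟦(1 : ℤ)⟧), XiProjective S P ∧
      IsBiexact S (Triangle.mk f g h) ∧ IsIteratedExtension S K := by
  induction hA with
  | of_hasResolution h =>
    obtain ⟨K, G, f, g, h, hG, H, hK⟩ := h.exists_biexact hS hE
    obtain ⟨L, P, f₂, g₂, h₂, hP, H₂, hL⟩ := hG.exists_biexact hS hE
    obtain ⟨B, i, k, a, b, hB, hB'⟩ := H.exists_comp H₂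
    exact ⟨B, P, i, _, k, hP, hB, .extension a b _ hB' hL (.of_hasResolution hK)⟩
  | extension f g h H hL _ ih =>
    obtain ⟨L', P, f₁, g₁, h₁, hP, H₁, hL'⟩ := hL.exists_biexact hS hE
    obtain ⟨K', Q, f₂, g₂, h₂, hQ, H₂, hK'⟩ := ih
    obtain ⟨A', R, i, p, k, a, b, c, hR, hA, hA'⟩ := H.exists_horseshoe hS H₁ hP H₂ hQ
    exact ⟨A', R, i, p, k, hR, hA, .extension a b c hA' hL' hK'⟩

end Resolutions

theorem proj_resolution_iff_gproj_resolution (S : Set (Triangle C))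
    (hS : IsProperClass S) (hE : HasEnoughXiProjectives S) (A : C) :
    HasResolution S (XiProjective S) (XiProjective S) A ↔
      HasResolution S (GProjective S) (XiProjective S) A := by
  refine ⟨fun h => h.mono fun _ hP => hP.gProjective hS hE, fun h => ?_⟩
  exact hasResolution_of_step hS hE (fun _ hB => IsIteratedExtension.exists_biexact hS hE hB)
    (IsIteratedExtension.of_hasResolution h)

end GorensteinTriangulated
end

section
/- Let 𝒞 be a triangulated category with a proper class ξ of triangles and enough ξ-projectives, and let A be an object of 𝒞. Then A is ξ-Gorenstein projective if and only if there exist Hom(−,𝒫(ξ))-exact triangles K_{n+1} → Gₙ → Kₙ → ΣK_{n+1} in ξ with Gₙ ∈ 𝒢𝒫(ξ) for all n ∈ ℤ and K₀ = A; i.e., complete resolutions by ξ-Gorenstein projective objects that are Hom(−,𝒫(ξ))-exact produce only ξ-Gorenstein projective objects. -/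
open CategoryTheory CategoryTheory.Limits CategoryTheory.Pretriangulated

namespace GorensteinTriangulated

variable {C : Type*} [Category C] [HasZeroObject C] [HasShift C ℤ] [Preadditive C]
  [∀ n : ℤ, (shiftFunctor C n).Additive] [Pretriangulated C]

section Mk

variable {X Y Z : C} {f : X ⟶ Y} {g : Y ⟶ Z} {h : Z ⟶ X⟦(1 : ℤ)⟧}

lemma rotate_mk (hT : Triangle.mk f g h ∈ distTriang C) :
    Triangle.mk g h (-f⟦(1 : ℤ)⟧') ∈ distTriang C :=
  rot_of_distTriang _ hT

lemma coyoneda_exact₁_mk (hT : Triangle.mk f g h ∈ distTriang C) {Q : C}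
    (φ : Q ⟶ X⟦(1 : ℤ)⟧) (hφ : φ ≫ f⟦(1 : ℤ)⟧' = 0) : ∃ ψ : Q ⟶ Z, φ = ψ ≫ h :=
  Triangle.coyoneda_exact₁ _ hT φ hφ

lemma coyoneda_exact₃_mk (hT : Triangle.mk f g h ∈ distTriang C) {Q : C}
    (φ : Q ⟶ Z) (hφ : φ ≫ h = 0) : ∃ ψ : Q ⟶ Y, φ = ψ ≫ g :=
  Triangle.coyoneda_exact₃ _ hT φ hφ

lemma yoneda_exact₃_mk (hT : Triangle.mk f g h ∈ distTriang C) {Q : C}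
    (φ : Z ⟶ Q) (hφ : g ≫ φ = 0) : ∃ ψ : X⟦(1 : ℤ)⟧ ⟶ Q, φ = h ≫ ψ :=
  Triangle.yoneda_exact₃ _ hT φ hφ

lemma mk_distinguished_of_iso (hT : Triangle.mk f g h ∈ distTriang C) {X' Y' Z' : C}
    {f' : X' ⟶ Y'} {g' : Y' ⟶ Z'} {h' : Z' ⟶ X'⟦(1 : ℤ)⟧} (e₁ : X' ≅ X) (e₂ : Y' ≅ Y)
    (e₃ : Z' ≅ Z) (h₁ : f' ≫ e₂.hom = e₁.hom ≫ f) (h₂ : g' ≫ e₃.hom = e₂.hom ≫ g)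
    (h₃ : h' ≫ e₁.hom⟦(1 : ℤ)⟧' = e₃.hom ≫ h) : Triangle.mk f' g' h' ∈ distTriang C :=
  isomorphic_distinguished _ hT _ (Triangle.isoMk _ _ e₁ e₂ e₃ h₁ h₂ h₃)

end Mk

/-- A morphism annihilated by composition with morphisms from, and to, objects in `𝒬`. -/
structure BiPhantom (𝒬 : C → Prop) {A B : C} (h : A ⟶ B) : Prop where
  precomp : ∀ {Q : C}, 𝒬 Q → ∀ f : Q ⟶ A, f ≫ h = 0
  postcomp : ∀ {Q : C}, 𝒬 Q → ∀ f : B ⟶ Q, h ≫ f = 0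

lemma BiPhantom.comp_left {𝒬 : C → Prop} {A B D : C} {h : B ⟶ D} (hh : BiPhantom 𝒬 h)
    (f : A ⟶ B) : BiPhantom 𝒬 (f ≫ h) where
  precomp hQ g := by rw [← Category.assoc, hh.precomp hQ]
  postcomp hQ g := by rw [Category.assoc, hh.postcomp hQ, comp_zero]

lemma BiPhantom.comp_right {𝒬 : C → Prop} {A B D : C} {h : A ⟶ B} (hh : BiPhantom 𝒬 h)
    (f : B ⟶ D) : BiPhantom 𝒬 (h ≫ f) where
  precomp hQ g := by rw [← Category.assoc, hh.precomp hQ, zero_comp]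
  postcomp hQ g := by rw [Category.assoc, hh.postcomp hQ]

/-- There is a distinguished triangle `X ⟶ Y ⟶ Z ⟶ ΣX` whose connecting morphism is
annihilated by `𝒬` on both sides. -/
def BiExact (𝒬 : C → Prop) (X Y Z : C) : Prop :=
  ∃ (f : X ⟶ Y) (g : Y ⟶ Z) (h : Z ⟶ X⟦(1 : ℤ)⟧),
    Triangle.mk f g h ∈ distTriang C ∧ BiPhantom 𝒬 h

/-- `A` embeds into an object satisfying `𝒢` with cokernel `B`, through a triangle whose
connecting morphism is annihilated by `𝒬` on both sides. -/
def Step (𝒢 𝒬 : C → Prop) (A B : C) : Prop :=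
  ∃ G : C, 𝒢 G ∧ BiExact 𝒬 A G B

lemma BiExact.of_iso₁ {𝒬 : C → Prop} {X X' Y Z : C} (H : BiExact 𝒬 X Y Z) (e : X ≅ X') :
    BiExact 𝒬 X' Y Z := by
  obtain ⟨f, g, h, hT, hh⟩ := H
  refine ⟨e.inv ≫ f, g, h ≫ e.hom⟦(1 : ℤ)⟧', ?_, hh.comp_right _⟩
  exact mk_distinguished_of_iso hT e.symm (Iso.refl _) (Iso.refl _) (by simp) (by simp)
    (by simp [← Functor.map_comp])

lemma BiExact.of_iso₃ {𝒬 : C → Prop} {X Y Z Z' : C} (H : BiExact 𝒬 X Y Z) (e : Z ≅ Z') :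
    BiExact 𝒬 X Y Z' := by
  obtain ⟨f, g, h, hT, hh⟩ := H
  refine ⟨f, g ≫ e.hom, e.inv ≫ h, ?_, hh.comp_left _⟩
  exact mk_distinguished_of_iso hT (Iso.refl _) (Iso.refl _) e.symm (by simp) (by simp)
    (by simp)

lemma exists_extension {X Y Z Q : C} {f : X ⟶ Y} {g : Y ⟶ Z} {h : Z ⟶ X⟦(1 : ℤ)⟧}
    (hT : Triangle.mk f g h ∈ distTriang C) (φ : X ⟶ Q) (hφ : h ≫ φ⟦(1 : ℤ)⟧' = 0) :
    ∃ ψ : Y ⟶ Q, f ≫ ψ = φ := by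
  obtain ⟨χ, hχ⟩ := yoneda_exact₃_mk (rotate_mk hT) (φ⟦(1 : ℤ)⟧') hφ
  obtain ⟨ψ, rfl⟩ := (shiftFunctor C (1 : ℤ)).map_surjective χ
  refine ⟨-ψ, (shiftFunctor C (1 : ℤ)).map_injective ?_⟩
  simpa using hχ.symm

lemma exists_factor_shift₂ {X Y Z Q : C} {f : X ⟶ Y} {g : Y ⟶ Z} {h : Z ⟶ X⟦(1 : ℤ)⟧}
    (hT : Triangle.mk f g h ∈ distTriang C) (φ : X⟦(1 : ℤ)⟧ ⟶ Q) (hφ : h ≫ φ = 0) :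
    ∃ ψ : Y⟦(1 : ℤ)⟧ ⟶ Q, φ = f⟦(1 : ℤ)⟧' ≫ ψ := by
  obtain ⟨ψ, hψ⟩ := yoneda_exact₃_mk (rotate_mk hT) φ hφ
  exact ⟨-ψ, by simpa using hψ⟩

lemma exists_factor_shift₃ {X Y Z Q : C} {f : X ⟶ Y} {g : Y ⟶ Z} {h : Z ⟶ X⟦(1 : ℤ)⟧}
    (hT : Triangle.mk f g h ∈ distTriang C) (φ : Y⟦(1 : ℤ)⟧ ⟶ Q)
    (hφ : f⟦(1 : ℤ)⟧' ≫ φ = 0) :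
    ∃ ψ : Z⟦(1 : ℤ)⟧ ⟶ Q, φ = g⟦(1 : ℤ)⟧' ≫ ψ :=
  exists_factor_shift₂ (rotate_mk hT) φ (by simpa using hφ)

lemma nonempty_iso_of_mor₃_eq_zero {X Y Y' Z : C} {f : X ⟶ Y} {g : Y ⟶ Z} {f' : X ⟶ Y'}
    {g' : Y' ⟶ Z} {h h' : Z ⟶ X⟦(1 : ℤ)⟧} (hT : Triangle.mk f g h ∈ distTriang C)
    (hT' : Triangle.mk f' g' h' ∈ distTriang C) (hh : h = 0) (hh' : h' = 0) :
    Nonempty (Y ≅ Y') := by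
  obtain ⟨e, -, -⟩ := exists_iso_binaryBiproduct_of_distTriang _ hT hh
  obtain ⟨e', -, -⟩ := exists_iso_binaryBiproduct_of_distTriang _ hT' hh'
  exact ⟨e ≪≫ e'.symm⟩

lemma exists_int_seq {α : Type*} {R : α → α → Prop} (hl : ∀ a, ∃ b, R b a)
    (hr : ∀ a, ∃ b, R a b) (a : α) :
    ∃ K : ℤ → α, K 0 = a ∧ ∀ n : ℤ, R (K (n + 1)) (K n) := by
  choose l hl using hl
  choose r hr using hr
  refine ⟨fun n => match n with
    | .ofNat n => l^[n] a
    | .negSucc n => r^[n + 1] a, rfl, ?_⟩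
  rintro (n | n)
  · change R (l^[n + 1] a) (l^[n] a)
    rw [Function.iterate_succ_apply']
    exact hl _
  · cases n with
    | zero => exact hr a
    | succ n =>
      change R (r^[n + 1] a) (r^[n + 1 + 1] a)
      rw [Function.iterate_succ_apply' r (n + 1)]
      exact hr _

section Triangulated

variable [IsTriangulated C]

/-- Base change of a distinguished triangle along the second morphism of another one. -/
lemma exists_baseChange {X Y Z K P : C} {f : X ⟶ Y} {g : Y ⟶ Z} {h : Z ⟶ X⟦(1 : ℤ)⟧}
    {a : K ⟶ P} {b : P ⟶ Z} {c : Z ⟶ K⟦(1 : ℤ)⟧} (hT : Triangle.mk f g h ∈ distTriang C)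
    (hT' : Triangle.mk a b c ∈ distTriang C) :
    ∃ (W : C) (f' : X ⟶ W) (g' : W ⟶ P) (α : K ⟶ W) (β : W ⟶ Y),
      Triangle.mk f' g' (b ≫ h) ∈ distTriang C ∧ Triangle.mk α β (g ≫ c) ∈ distTriang C ∧
      f' ≫ β = f ∧ g' ≫ b = β ≫ g ∧ α ≫ g' = a := by
  obtain ⟨W, α, β, hW⟩ := distinguished_cocone_triangle₂ (g ≫ c)
  have o := Triangulated.someOctahedron' rfl hT (rotate_mk hT') (rotate_mk hW)
  refine ⟨W, o.m₁, o.m₃, α, β, o.mem, hW, o.comm₁, o.comm₄,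
    (shiftFunctor C (1 : ℤ)).map_injective ?_⟩
  have := o.comm₃
  simpa using this

variable {𝒬 : C → Prop}

/-- A composite of two admissible monomorphisms is an admissible monomorphism. -/
lemma BiExact.comp_mono {A G K P B : C} (h₁ : BiExact 𝒬 A G K) (h₂ : BiExact 𝒬 G P B) :
    ∃ D, BiExact 𝒬 A P D ∧ BiExact 𝒬 K D B := by
  obtain ⟨u, v, w, hT, hw⟩ := h₁
  obtain ⟨u', v', w', hT', hw'⟩ := h₂
  obtain ⟨D, p, q, hD⟩ := distinguished_cocone_triangle (u ≫ u')
  have o := Triangulated.someOctahedron rfl hT hT' hD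
  refine ⟨D, ⟨_, _, _, hD, ?_, ?_⟩, ⟨_, _, _, o.mem, hw'.comp_right _⟩⟩
  · intro Q hQ φ
    obtain ⟨ψ, hψ⟩ := coyoneda_exact₁_mk hT (φ ≫ q) (by
      rw [Category.assoc]
      exact (congrArg (φ ≫ ·) o.comm₄).trans ((hw'.comp_left o.m₃).precomp hQ φ))
    exact hψ.trans (hw.precomp hQ ψ)
  · intro Q hQ φ
    obtain ⟨ψ, rfl⟩ := exists_factor_shift₂ hT φ (hw.postcomp hQ φ)
    rw [reassoc_of% o.comm₄, hw'.postcomp hQ, comp_zero]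

/-- A composite of two admissible epimorphisms is an admissible epimorphism. -/
lemma BiExact.comp_epi {K G A B P : C} (h₁ : BiExact 𝒬 K G A) (h₂ : BiExact 𝒬 B P G) :
    ∃ D, BiExact 𝒬 D P A ∧ BiExact 𝒬 B D K := by
  obtain ⟨u, v, w, hT, hw⟩ := h₁
  obtain ⟨u', v', w', hT', hw'⟩ := h₂
  obtain ⟨D, p, q, hD⟩ := distinguished_cocone_triangle₁ (v' ≫ v)
  have o := Triangulated.someOctahedron' rfl hT' hT hD
  refine ⟨D, ⟨_, _, _, hD, ?_, ?_⟩, ⟨_, _, _, o.mem, hw'.comp_left _⟩⟩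
  · intro Q hQ φ
    obtain ⟨ψ, rfl⟩ := coyoneda_exact₃_mk hT φ (hw.precomp hQ φ)
    rw [Category.assoc, ← o.comm₂]
    exact (hw'.comp_right _).precomp hQ ψ
  · intro Q hQ φ
    obtain ⟨θ, hθ⟩ := exists_factor_shift₂ hT' (o.m₁⟦(1 : ℤ)⟧' ≫ φ) (hw'.postcomp hQ _)
    obtain ⟨ρ, hρ⟩ := exists_factor_shift₃ o.mem (φ - p⟦(1 : ℤ)⟧' ≫ θ) (by
      rw [Preadditive.comp_sub, hθ, ← Functor.map_comp_assoc, o.comm₁, sub_self])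
    have hq : q ≫ p⟦(1 : ℤ)⟧' = 0 := comp_distTriang_mor_zero₃₁ _ hD
    rw [sub_eq_iff_eq_add.mp hρ, Preadditive.comp_add, reassoc_of% o.comm₃, reassoc_of% hq,
      zero_comp, add_zero, hw.postcomp hQ]

/-- Horseshoe lemma for cosyzygies. -/
lemma BiExact.horseshoe_cosyzygy (hshift : ∀ Q, 𝒬 Q → 𝒬 (Q⟦(1 : ℤ)⟧))
    (hsum : ∀ P Q, 𝒬 P → 𝒬 Q → 𝒬 (P ⊞ Q)) {X Y Z X₁ Z₁ : C} (H : BiExact 𝒬 X Y Z)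
    (hX : Step 𝒬 𝒬 X X₁) (hZ : Step 𝒬 𝒬 Z Z₁) :
    ∃ Y₁, Step 𝒬 𝒬 Y Y₁ ∧ BiExact 𝒬 X₁ Y₁ Z₁ := by
  obtain ⟨f, g, h, hT, hh⟩ := H
  obtain ⟨P, hP, i, p, k, hTP, hk⟩ := hX
  obtain ⟨P', hP', i', p', k', hTP', hk'⟩ := hZ
  obtain ⟨W, f', g', α, β, hW, hW', -⟩ :=
    exists_baseChange (rotate_mk hT) (rotate_mk hTP)
  obtain ⟨V, v, q, hV⟩ := distinguished_cocone_triangle₁ ((biprod.snd : P ⊞ P' ⟶ P') ≫ p')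
  have o := Triangulated.someOctahedron' rfl (binaryBiproductTriangle_distinguished P P')
    hTP' hV
  obtain ⟨θ, hθ⟩ := yoneda_exact₃_mk hTP' q (o.comm₂.symm.trans zero_comp)
  obtain ⟨e⟩ := nonempty_iso_of_mor₃_eq_zero o.mem hW' comp_zero
    (hh.postcomp (hshift _ hP) _)
  have hVP : BiExact 𝒬 V (P ⊞ P') Z₁ := ⟨_, _, _, hV, by
    rw [hθ]
    exact hk'.comp_right θ⟩
  have hYW : BiExact 𝒬 Y W X₁ := ⟨_, _, _, hW, hk.comp_right _⟩
  obtain ⟨D, hD, hD'⟩ := hYW.comp_mono (hVP.of_iso₁ e)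
  exact ⟨D, ⟨_, hsum _ _ hP hP', hD⟩, hD'⟩

/-- Horseshoe lemma for syzygies. -/
lemma BiExact.horseshoe_syzygy (hsum : ∀ P Q, 𝒬 P → 𝒬 Q → 𝒬 (P ⊞ Q))
    {X Y Z X₁ Z₁ : C} (H : BiExact 𝒬 X Y Z)
    (hX : Step 𝒬 𝒬 X₁ X) (hZ : Step 𝒬 𝒬 Z₁ Z) :
    ∃ Y₁, Step 𝒬 𝒬 Y₁ Y ∧ BiExact 𝒬 X₁ Y₁ Z₁ := by
  obtain ⟨f, g, h, hT, hh⟩ := H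
  obtain ⟨P, hP, i, p, k, hTP, hk⟩ := hX
  obtain ⟨P', hP', i', p', k', hTP', hk'⟩ := hZ
  obtain ⟨W, f', g', α, β, hW, hW', -⟩ := exists_baseChange hT hTP'
  obtain ⟨V, v, q, hV⟩ := distinguished_cocone_triangle (i ≫ (biprod.inl : P ⟶ P ⊞ P'))
  have o := Triangulated.someOctahedron rfl hTP (binaryBiproductTriangle_distinguished P P') hV
  obtain ⟨θ, hθ⟩ := coyoneda_exact₁_mk hTP q (o.comm₄.trans comp_zero)
  obtain ⟨e⟩ := nonempty_iso_of_mor₃_eq_zero o.mem hW zero_comp (hh.precomp hP' _)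
  have hVP : BiExact 𝒬 X₁ (P ⊞ P') V := ⟨_, _, _, hV, by
    rw [hθ]
    exact hk.comp_left θ⟩
  have hWY : BiExact 𝒬 Z₁ W Y := ⟨_, _, _, hW', hk'.comp_left _⟩
  obtain ⟨D, hD, hD'⟩ := hWY.comp_epi (hVP.of_iso₃ e)
  exact ⟨D, ⟨_, hsum _ _ hP hP', hD⟩, hD'⟩

end Triangulated

section Resolutions

variable {𝒢 𝒬 : C → Prop}

/-- The iterated extensions, through `BiExact`, of objects satisfying `𝒢`. -/
inductive Fil (𝒬 𝒢 : C → Prop) : C → Prop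
  | base {A : C} : 𝒢 A → Fil 𝒬 𝒢 A
  | ext {X Y Z : C} : BiExact 𝒬 X Y Z → Fil 𝒬 𝒢 X → Fil 𝒬 𝒢 Z → Fil 𝒬 𝒢 Y

/-- `A` occurs as a syzygy in a two-sided resolution by objects satisfying `𝒢`. -/
def StepClass (𝒢 𝒬 : C → Prop) (A : C) : Prop :=
  ∃ K : ℤ → C, K 0 = A ∧ ∀ n : ℤ, Step 𝒢 𝒬 (K (n + 1)) (K n)

lemma StepClass.of_seq {K : ℤ → C} (hK : ∀ n : ℤ, Step 𝒢 𝒬 (K (n + 1)) (K n)) (m : ℤ) :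
    StepClass 𝒢 𝒬 (K m) :=
  ⟨fun n => K (n + m), by simp, fun n => by simpa only [add_right_comm] using hK (n + m)⟩

lemma StepClass.exists_cosyzygy {A : C} (h : StepClass 𝒢 𝒬 A) :
    ∃ B, StepClass 𝒢 𝒬 B ∧ Step 𝒢 𝒬 A B := by
  obtain ⟨K, rfl, hK⟩ := h
  exact ⟨K (-1), .of_seq hK _, by simpa using hK (-1)⟩

lemma StepClass.exists_syzygy {A : C} (h : StepClass 𝒢 𝒬 A) :
    ∃ B, StepClass 𝒢 𝒬 B ∧ Step 𝒢 𝒬 B A := by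
  obtain ⟨K, rfl, hK⟩ := h
  exact ⟨K 1, .of_seq hK _, by simpa using hK 0⟩

lemma StepClass.mono {𝒢' : C → Prop} (hle : ∀ A, 𝒢 A → 𝒢' A) {A : C}
    (h : StepClass 𝒢 𝒬 A) : StepClass 𝒢' 𝒬 A := by
  obtain ⟨K, hK₀, hK⟩ := h
  exact ⟨K, hK₀, fun n => (hK n).imp fun _ hG => hG.imp_left (hle _)⟩

lemma stepClass_of_mem (hsum : ∀ P Q, 𝒬 P → 𝒬 Q → 𝒬 (P ⊞ Q)) {P : C} (hP : 𝒬 P) :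
    StepClass 𝒬 𝒬 P :=
  ⟨fun _ => P, rfl, fun _ => ⟨P ⊞ P, hsum _ _ hP hP, _, _, _,
    binaryBiproductTriangle_distinguished P P, fun _ _ => comp_zero, fun _ _ => zero_comp⟩⟩

/-- Complete resolutions exist for every class closed under syzygies and cosyzygies. -/
lemma StepClass.of_closed {𝒜 : C → Prop} (hl : ∀ A, 𝒜 A → ∃ B, 𝒜 B ∧ Step 𝒢 𝒬 B A)
    (hr : ∀ A, 𝒜 A → ∃ B, 𝒜 B ∧ Step 𝒢 𝒬 A B) {A : C} (hA : 𝒜 A) : StepClass 𝒢 𝒬 A := by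
  obtain ⟨K, hK₀, hK⟩ := exists_int_seq (α := {A // 𝒜 A}) (R := fun B A => Step 𝒢 𝒬 B.1 A.1)
    (fun A => by
      obtain ⟨B, hB, h⟩ := hl A.1 A.2
      exact ⟨⟨B, hB⟩, h⟩)
    (fun A => by
      obtain ⟨B, hB, h⟩ := hr A.1 A.2
      exact ⟨⟨B, hB⟩, h⟩) ⟨A, hA⟩
  exact ⟨fun n => (K n).1, congrArg Subtype.val hK₀, hK⟩

variable [IsTriangulated C]

lemma Fil.exists_cosyzygy (hshift : ∀ Q, 𝒬 Q → 𝒬 (Q⟦(1 : ℤ)⟧))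
    (hsum : ∀ P Q, 𝒬 P → 𝒬 Q → 𝒬 (P ⊞ Q))
    (hle : ∀ A, StepClass 𝒬 𝒬 A → StepClass (StepClass 𝒬 𝒬) 𝒬 A)
    {A : C} (hA : Fil 𝒬 (StepClass (StepClass 𝒬 𝒬) 𝒬) A) :
    ∃ B, Fil 𝒬 (StepClass (StepClass 𝒬 𝒬) 𝒬) B ∧ Step 𝒬 𝒬 A B := by
  induction hA with
  | base hA =>
    obtain ⟨K, hK, G, hG, hAK⟩ := hA.exists_cosyzygy
    obtain ⟨G', hG', P, hP, hGP⟩ := hG.exists_cosyzygy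
    obtain ⟨D, hD, hD'⟩ := hAK.comp_mono hGP
    exact ⟨D, .ext hD' (.base hK) (.base (hle _ hG')), P, hP, hD⟩
  | ext h _ _ ihX ihZ =>
    obtain ⟨X₁, hX₁, hX⟩ := ihX
    obtain ⟨Z₁, hZ₁, hZ⟩ := ihZ
    obtain ⟨Y₁, hY, hY₁⟩ := h.horseshoe_cosyzygy hshift hsum hX hZ
    exact ⟨Y₁, .ext hY₁ hX₁ hZ₁, hY⟩

lemma Fil.exists_syzygy (hsum : ∀ P Q, 𝒬 P → 𝒬 Q → 𝒬 (P ⊞ Q))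
    (hle : ∀ A, StepClass 𝒬 𝒬 A → StepClass (StepClass 𝒬 𝒬) 𝒬 A)
    {A : C} (hA : Fil 𝒬 (StepClass (StepClass 𝒬 𝒬) 𝒬) A) :
    ∃ B, Fil 𝒬 (StepClass (StepClass 𝒬 𝒬) 𝒬) B ∧ Step 𝒬 𝒬 B A := by
  induction hA with
  | base hA =>
    obtain ⟨K, hK, G, hG, hKA⟩ := hA.exists_syzygy
    obtain ⟨G', hG', P, hP, hGP⟩ := hG.exists_syzygy
    obtain ⟨D, hD, hD'⟩ := hKA.comp_epi hGP
    exact ⟨D, .ext hD' (.base (hle _ hG')) (.base hK), P, hP, hD⟩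
  | ext h _ _ ihX ihZ =>
    obtain ⟨X₁, hX₁, hX⟩ := ihX
    obtain ⟨Z₁, hZ₁, hZ⟩ := ihZ
    obtain ⟨Y₁, hY, hY₁⟩ := h.horseshoe_syzygy hsum hX hZ
    exact ⟨Y₁, .ext hY₁ hX₁ hZ₁, hY⟩

lemma stepClass_stepClass_iff (hshift : ∀ Q, 𝒬 Q → 𝒬 (Q⟦(1 : ℤ)⟧))
    (hsum : ∀ P Q, 𝒬 P → 𝒬 Q → 𝒬 (P ⊞ Q)) (A : C) :
    StepClass (StepClass 𝒬 𝒬) 𝒬 A ↔ StepClass 𝒬 𝒬 A := by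
  have hle : ∀ A, StepClass 𝒬 𝒬 A → StepClass (StepClass 𝒬 𝒬) 𝒬 A :=
    fun A => .mono fun _ => stepClass_of_mem hsum
  exact ⟨fun h => .of_closed (fun _ => Fil.exists_syzygy hsum hle)
    (fun _ => Fil.exists_cosyzygy hshift hsum hle) (.base h), hle A⟩

end Resolutions

section ProperClass

variable {S : Set (Triangle C)}

lemma XiProjective.comp_mor₃_s10 {P X Y Z : C} (hP : XiProjective S P) {f : X ⟶ Y} {g : Y ⟶ Z}
    {h : Z ⟶ X⟦(1 : ℤ)⟧} (hT : Triangle.mk f g h ∈ distTriang C) (hTS : Triangle.mk f g h ∈ S)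
    (φ : P ⟶ Z) : φ ≫ h = 0 := by
  obtain ⟨ψ, hψ⟩ : ∃ ψ : P ⟶ Y, ψ ≫ g = φ := (hP _ hTS).2.2 φ
  have hgh : g ≫ h = 0 := comp_distTriang_mor_zero₂₃ _ hT
  rw [← hψ, Category.assoc, hgh, comp_zero]

namespace IsProperClass

lemma comp_shift_eq_zero (hS : IsProperClass S) {P : C}
    (hP : ∀ T ∈ S, ∀ f : P ⟶ T.obj₃, f ≫ T.mor₃ = 0) {T : Triangle C} (hT : T ∈ S) {n : ℤ}
    (f : P ⟶ T.obj₃⟦n⟧) : f ≫ T.mor₃⟦n⟧' = 0 := by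
  have h : f ≫ (n.negOnePow • T.mor₃⟦n⟧' ≫ (shiftFunctorComm C 1 n).hom.app T.obj₁) = 0 :=
    hP _ (hS.susp_closed T hT n) f
  rw [Linear.comp_units_smul, smul_eq_zero_iff_eq] at h
  rwa [← cancel_mono ((shiftFunctorComm C 1 n).hom.app T.obj₁), Category.assoc, zero_comp]

lemma xiProjective_iff (hS : IsProperClass S) {P : C} :
    XiProjective S P ↔ ∀ T ∈ S, ∀ f : P ⟶ T.obj₃, f ≫ T.mor₃ = 0 := by
  refine ⟨fun hP T hT f => hP.comp_mor₃_s10 (hS.subset_dist hT) hT f, fun hP T hT => ⟨?_, ?_, ?_⟩⟩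
  · intro φ φ' h
    have hφ : (φ - φ') ≫ T.mor₁ = 0 := by
      rw [Preadditive.sub_comp, sub_eq_zero]
      exact h
    obtain ⟨χ, hχ⟩ := Triangle.coyoneda_exact₂ _
      (inv_rot_of_distTriang _ (hS.subset_dist hT)) (φ - φ') hφ
    obtain ⟨χ, u, hχ⟩ : ∃ (χ : P ⟶ T.obj₃⟦(-1 : ℤ)⟧) (u : T.obj₁⟦(1 : ℤ)⟧⟦(-1 : ℤ)⟧ ⟶ T.obj₁),
        φ - φ' = χ ≫ (-T.mor₃⟦(-1 : ℤ)⟧' ≫ u) := ⟨χ, _, hχ⟩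
    rw [← sub_eq_zero, hχ, Preadditive.comp_neg, ← Category.assoc,
      hS.comp_shift_eq_zero hP hT, zero_comp, neg_zero]
  · exact Triangle.coyoneda_exact₂ _ (hS.subset_dist hT)
  · intro φ
    obtain ⟨ψ, hψ⟩ := Triangle.coyoneda_exact₃ _ (hS.subset_dist hT) φ (hP T hT φ)
    exact ⟨ψ, hψ.symm⟩

lemma xiProjective_shift (hS : IsProperClass S) {P : C} (hP : XiProjective S P) (n : ℤ) :
    XiProjective S (P⟦n⟧) := by
  rw [hS.xiProjective_iff] at hP ⊢
  intro T hT f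
  have h := hS.comp_shift_eq_zero hP hT ((shiftShiftNeg P n).inv ≫ f⟦-n⟧')
  rw [Category.assoc, ← Functor.map_comp, Preadditive.IsIso.comp_left_eq_zero] at h
  exact (Functor.map_eq_zero_iff _).mp h

lemma xiProjective_biprod (hS : IsProperClass S) {P Q : C} (hP : XiProjective S P)
    (hQ : XiProjective S Q) : XiProjective S (P ⊞ Q) := by
  rw [hS.xiProjective_iff] at *
  intro T hT f
  ext
  · rw [← Category.assoc, hP T hT, comp_zero]
  · rw [← Category.assoc, hQ T hT, comp_zero]

lemma mem_of_comp_mor₃_eq_zero [IsTriangulated C] (hS : IsProperClass S)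
    (hE : HasEnoughXiProjectives S) {X Y Z : C} {f : X ⟶ Y} {g : Y ⟶ Z} {h : Z ⟶ X⟦(1 : ℤ)⟧}
    (hT : Triangle.mk f g h ∈ distTriang C)
    (hh : ∀ {P : C}, XiProjective S P → ∀ φ : P ⟶ Z, φ ≫ h = 0) : Triangle.mk f g h ∈ S := by
  obtain ⟨K, P, a, b, c, hP, hab⟩ := hE Z
  obtain ⟨W, f', g', α, β, hW, hW', h₁, h₂, h₃⟩ := exists_baseChange hT (hS.subset_dist hab)
  refine hS.saturated _ hT K W P α a f' g' (b ≫ h) β b (g ≫ c) c hW' ?_ hab h₃ h₁ h₂ rfl rfl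
  obtain ⟨e, he₁, he₂⟩ := exists_iso_binaryBiproduct_of_distTriang _ hW (hh hP b)
  refine hS.split_mem _ hW ⟨Triangle.isoMk _ _ (Iso.refl _) e (Iso.refl _) ?_ ?_ ?_⟩
  · exact he₁.trans (Category.id_comp _).symm
  · exact (Category.comp_id _).trans he₂
  · have h₀ : b ≫ h = 0 := hh hP b
    exact (congrArg (· ≫ _) h₀).trans (zero_comp.trans comp_zero.symm)

/-- The `Hom(-, 𝒫(ξ))`-exact triangles in `ξ` are the distinguished triangles whose connecting
morphism is annihilated by the `ξ`-projectives on both sides. -/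
lemma mem_and_contraExact_iff [IsTriangulated C] (hS : IsProperClass S)
    (hE : HasEnoughXiProjectives S) {X Y Z : C} {f : X ⟶ Y} {g : Y ⟶ Z} {h : Z ⟶ X⟦(1 : ℤ)⟧} :
    (Triangle.mk f g h ∈ S ∧ ∀ Q, XiProjective S Q → ContraExact (Triangle.mk f g h) Q) ↔
      Triangle.mk f g h ∈ distTriang C ∧ BiPhantom (XiProjective S) h := by
  constructor
  · rintro ⟨hTS, hex⟩
    have hT := hS.subset_dist hTS
    refine ⟨hT, fun hQ φ => hQ.comp_mor₃_s10 hT hTS φ, fun {Q} hQ φ => ?_⟩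
    obtain ⟨φ', hφ'⟩ := (shiftFunctor C (1 : ℤ)).map_surjective (φ ≫ (shiftNegShift Q (1 : ℤ)).inv)
    obtain ⟨ψ, hψ⟩ : ∃ ψ : Y ⟶ Q⟦(-1 : ℤ)⟧, f ≫ ψ = φ' :=
      (hex _ (hS.xiProjective_shift hQ (-1))).2.2 φ'
    have hhf : h ≫ f⟦(1 : ℤ)⟧' = 0 := comp_distTriang_mor_zero₃₁ _ hT
    rw [← cancel_mono (shiftNegShift Q (1 : ℤ)).inv, Category.assoc, ← hφ', ← hψ, Functor.map_comp,
      reassoc_of% hhf, zero_comp, zero_comp]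
  · rintro ⟨hT, hh⟩
    refine ⟨hS.mem_of_comp_mor₃_eq_zero hE hT hh.precomp, fun Q hQ => ⟨?_, ?_, ?_⟩⟩
    · intro (φ : Z ⟶ Q) (φ' : Z ⟶ Q) (hφ : g ≫ φ = g ≫ φ')
      obtain ⟨ψ, hψ⟩ := yoneda_exact₃_mk hT (φ - φ') (by rw [Preadditive.comp_sub, hφ, sub_self])
      exact sub_eq_zero.mp (hψ.trans (hh.postcomp hQ ψ))
    · exact Triangle.yoneda_exact₂ _ hT
    · exact fun φ => exists_extension hT φ (hh.postcomp (hS.xiProjective_shift hQ 1) _)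

lemma gClass_iff_stepClass [IsTriangulated C] (hS : IsProperClass S)
    (hE : HasEnoughXiProjectives S) {𝒢 : C → Prop} {A : C} :
    GClass S 𝒢 (XiProjective S) A ↔ StepClass 𝒢 (XiProjective S) A := by
  constructor
  · rintro ⟨K, P, f, g, h, hK, H⟩
    exact ⟨K, hK, fun n => ⟨P n, (H n).1, f n, g n, h n,
      (hS.mem_and_contraExact_iff hE).mp (H n).2⟩⟩
  · rintro ⟨K, hK, H⟩
    choose P hP f g h H using H
    exact ⟨K, P, f, g, h, hK, fun n => ⟨hP n, (hS.mem_and_contraExact_iff hE).mpr (H n)⟩⟩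

end IsProperClass

end ProperClass

variable [IsTriangulated C]

theorem gProjective_iff_gclass_gproj_proj (S : Set (Triangle C))
    (hS : IsProperClass S) (hE : HasEnoughXiProjectives S) (A : C) :
    GProjective S A ↔ GClass S (GProjective S) (XiProjective S) A := by
  have h : GProjective S = StepClass (XiProjective S) (XiProjective S) :=
    funext fun _ => propext (hS.gClass_iff_stepClass hE)
  rw [hS.gClass_iff_stepClass hE, h]
  exact (stepClass_stepClass_iff (𝒬 := XiProjective S) (fun _ hQ => hS.xiProjective_shift hQ 1)
    (fun _ _ => hS.xiProjective_biprod) A).symm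

end GorensteinTriangulated
end
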